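/- Let C be an isotropic convex body in ℝⁿ and K a centrally symmetric convex body in ℝⁿ. There is an absolute constant c > 0 such that for every s ≥ 1 and every t ∈ ℝˢ there exists U ∈ O(n) with ∫_{U(C)}⋯∫_{U(C)} ‖∑_{j=1}^s t_j x_j‖_K dx₁⋯dx_s ≥ c L_C √n M(K) ‖t‖₂. -/

import Mathlib

open MeasureTheory Real
open scoped ENNReal RealInnerProductSpace

noncomputable section

/-- A convex body: compact, convex, with non-empty interior. -/
def IsConvexBody {n : ℕ} (C : Set (EuclideanSpace ℝ (Fin n))) : Prop :=
  Convex ℝ C ∧ IsCompact C ∧ (interior C).Nonempty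

/-- A centrally symmetric convex body. -/
def IsSymmConvexBody {n : ℕ} (C : Set (EuclideanSpace ℝ (Fin n))) : Prop :=
  Convex ℝ C ∧ IsCompact C ∧ (interior C).Nonempty ∧ C = -C

/-- `C` is isotropic with isotropic constant `L`. -/
def IsIsotropic {n : ℕ} (C : Set (EuclideanSpace ℝ (Fin n))) (L : ℝ) : Prop :=
  volume C = 1 ∧ (∫ x in C, x) = 0 ∧ 0 < L ∧
    ∀ ξ : EuclideanSpace ℝ (Fin n), ‖ξ‖ = 1 → (∫ x in C, ⟪x, ξ⟫ ^ 2) = L ^ 2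

/-- `M(K) = ∫_{S^{n-1}} ‖ξ‖_K dσ(ξ)`. -/
def sphereM {n : ℕ} (K : Set (EuclideanSpace ℝ (Fin n))) : ℝ :=
  ⨍ ξ, gauge K (ξ : EuclideanSpace ℝ (Fin n))
    ∂((volume : Measure (EuclideanSpace ℝ (Fin n))).toSphere)

/-- The Euclidean norm of `t ∈ ℝˢ`. -/
def euclNorm {s : ℕ} (t : Fin s → ℝ) : ℝ := Real.sqrt (∑ j, t j ^ 2)

/-- One-dimensional Brunn-Minkowski inequality. -/
lemma volume_add_volume_le_of_add_mem {A B D : Set ℝ} (hA : MeasurableSet A)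
    (hB : MeasurableSet B) (hA0 : A.Nonempty) (hB0 : B.Nonempty)
    (h : ∀ a ∈ A, ∀ b ∈ B, a + b ∈ D) : volume A + volume B ≤ volume D := by
  have key : ∀ K ⊆ A, IsCompact K → ∀ K' ⊆ B, IsCompact K' → volume K + volume K' ≤ volume D := by
    intro K hKA hK K' hKB hK'
    obtain ⟨a, ha⟩ := hA0
    obtain ⟨b, hb⟩ := hB0
    have hi : IsCompact (insert a K) := hK.insert a
    have hi' : IsCompact (insert b K') := hK'.insert b
    obtain ⟨p, hp, hpmax⟩ := hi.exists_isGreatest (Set.insert_nonempty _ _)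
    obtain ⟨q, hq, hqmin⟩ := hi'.exists_isLeast (Set.insert_nonempty _ _)
    have hpA : p ∈ A := Set.insert_subset ha hKA hp
    have hqB : q ∈ B := Set.insert_subset hb hKB hq
    have h1 : volume ((fun x => x + q) '' K) = volume K := by simp
    have h2 : volume (((fun x => p + x) '' K') \ {p + q}) = volume K' := by
      rw [measure_sdiff_null (measure_singleton _)]
      simp
    have hdisj : Disjoint ((fun x => x + q) '' K) (((fun x => p + x) '' K') \ {p + q}) := by
      rw [Set.disjoint_left]
      rintro _ ⟨x, hx, rfl⟩ ⟨⟨y, hy, hxy⟩, hne⟩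
      have hxp := hpmax (Set.mem_insert_of_mem a hx)
      have hqy := hqmin (Set.mem_insert_of_mem b hy)
      apply hne
      simp only [Set.mem_singleton_iff] at hxy ⊢
      linarith
    rw [← h1, ← h2, ← measure_union hdisj]
    · apply measure_mono
      rintro _ (⟨x, hx, rfl⟩ | ⟨⟨y, hy, rfl⟩, -⟩)
      · exact h _ (hKA hx) _ hqB
      · exact h _ hpA _ (hKB hy)
    · exact MeasurableSet.diff (hK'.image (continuous_const_add p)).measurableSet
        (measurableSet_singleton _)
  refine le_of_forall_lt fun c hc => ?_
  rw [hA.measure_eq_iSup_isCompact, hB.measure_eq_iSup_isCompact] at hc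
  simp only [iSup_and'] at hc
  refine lt_of_lt_of_le hc ?_
  exact ENNReal.biSup_add_biSup_le' ⟨∅, Set.empty_subset _, isCompact_empty⟩
    ⟨∅, Set.empty_subset _, isCompact_empty⟩ fun K hK K' hK' => key K hK.1 hK.2 K' hK'.1 hK'.2

lemma mul_le_sq_of_add_le_two_mul {a b c : ℝ≥0∞} (h : a + b ≤ 2 * c) : a * b ≤ c ^ 2 := by
  rcases eq_or_ne c ⊤ with rfl | hc
  · simp
  have hab : a + b ≠ ⊤ := ne_top_of_le_ne_top (by finiteness) h
  lift c to NNReal using hc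
  lift a to NNReal using (by aesop)
  lift b to NNReal using (by aesop)
  norm_cast at h ⊢
  have h' : (a : ℝ) + b ≤ 2 * c := by exact_mod_cast h
  have : (a : ℝ) * b ≤ c ^ 2 := by
    nlinarith [sq_nonneg ((a : ℝ) - b), a.2, b.2, c.2]
  exact_mod_cast this

lemma lintegral_eq_lintegral_meas_ofReal_lt {α : Type*} [MeasurableSpace α] (μ : Measure α)
    {f : α → ℝ≥0∞} (hf : Measurable f) (hfin : ∀ x, f x ≠ ⊤) :
    ∫⁻ x, f x ∂μ = ∫⁻ t in Set.Ioi (0 : ℝ), μ {x | ENNReal.ofReal t < f x} := by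
  have := lintegral_eq_lintegral_meas_lt μ (f := fun x => (f x).toReal)
    (Filter.Eventually.of_forall fun x => ENNReal.toReal_nonneg) (by fun_prop)
  simp only [ENNReal.ofReal_toReal (hfin _)] at this
  rw [this]
  refine setLIntegral_congr_fun measurableSet_Ioi fun t ht => ?_
  congr 1
  ext x
  exact (ENNReal.ofReal_lt_iff_lt_toReal (le_of_lt ht) (hfin x)).symm

open scoped Pointwise in
lemma lintegral_mul_lintegral_le_of_sup_eq_one {f g h : ℝ → ℝ≥0∞} (hf : Measurable f)
    (hg : Measurable g) (hh : Measurable h) (hf1 : ⨆ x, f x = 1) (hg1 : ⨆ x, g x = 1)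
    (H : ∀ x y, f x * g y ≤ h ((2 : ℝ)⁻¹ • (x + y)) ^ 2) :
    (∫⁻ x, f x) * (∫⁻ x, g x) ≤ (∫⁻ x, h x) ^ 2 := by
  have hfle : ∀ x, f x ≤ 1 := fun x => hf1 ▸ le_iSup f x
  have hgle : ∀ x, g x ≤ 1 := fun x => hg1 ▸ le_iSup g x
  have hm : ∫⁻ x, min (h x) 1 ≤ ∫⁻ x, h x := lintegral_mono fun x => min_le_left _ _
  refine le_trans ?_ (pow_le_pow_left₀ zero_le hm 2)
  apply mul_le_sq_of_add_le_two_mul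
  rw [lintegral_eq_lintegral_meas_ofReal_lt _ hf (fun x => ((hfle x).trans_lt (by simp)).ne),
    lintegral_eq_lintegral_meas_ofReal_lt _ hg (fun x => ((hgle x).trans_lt (by simp)).ne),
    lintegral_eq_lintegral_meas_ofReal_lt _ (hh.min measurable_const)
      (fun x => ((min_le_right _ _).trans_lt (by simp)).ne),
    ← lintegral_const_mul' _ _ (by simp), ← lintegral_add_left']
  swap
  · refine Measurable.aemeasurable (Antitone.measurable ?_)
    intro s t hst
    exact measure_mono fun x hx => lt_of_le_of_lt (ENNReal.ofReal_le_ofReal hst) hx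
  refine setLIntegral_mono' measurableSet_Ioi fun t ht => ?_
  rcases le_or_gt 1 (ENNReal.ofReal t) with h1 | h1
  · have e1 : {x | ENNReal.ofReal t < f x} = ∅ := by
      ext x; simpa using (hfle x).trans h1
    have e2 : {x | ENNReal.ofReal t < g x} = ∅ := by
      ext x; simpa using (hgle x).trans h1
    simp [e1, e2]
  · have n1 : {x | ENNReal.ofReal t < f x}.Nonempty := by
      rw [← hf1] at h1; exact lt_iSup_iff.1 h1
    have n2 : {x | ENNReal.ofReal t < g x}.Nonempty := by
      rw [← hg1] at h1; exact lt_iSup_iff.1 h1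
    have e : 2 * volume {x | ENNReal.ofReal t < min (h x) 1}
        = volume ((2 : ℝ) • {x | ENNReal.ofReal t < min (h x) 1}) := by
      rw [Measure.addHaar_smul]
      simp
    rw [e]
    refine volume_add_volume_le_of_add_mem (hf measurableSet_Ioi) (hg measurableSet_Ioi) n1 n2 ?_
    intro x hx y hy
    rw [Set.mem_smul_set_iff_inv_smul_mem₀ two_ne_zero]
    refine lt_min ?_ h1
    have := (ENNReal.mul_lt_mul hx hy).trans_le (H x y)
    rw [← sq] at this
    exact lt_of_not_ge fun hle => this.not_ge (pow_le_pow_left' hle 2)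

lemma lintegral_mul_lintegral_le_of_bdd {f g h : ℝ → ℝ≥0∞} (hf : Measurable f)
    (hg : Measurable g) (hh : Measurable h) (hf1 : ⨆ x, f x ≠ ⊤) (hg1 : ⨆ x, g x ≠ ⊤)
    (H : ∀ x y, f x * g y ≤ h ((2 : ℝ)⁻¹ • (x + y)) ^ 2) :
    (∫⁻ x, f x) * (∫⁻ x, g x) ≤ (∫⁻ x, h x) ^ 2 := by
  set F := ⨆ x, f x with hF
  set G := ⨆ x, g x with hG
  rcases eq_or_ne F 0 with hF0 | hF0
  · have : ∀ x, f x = 0 := fun x => le_antisymm (hF0 ▸ le_iSup f x) zero_le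
    simp [this]
  rcases eq_or_ne G 0 with hG0 | hG0
  · have : ∀ x, g x = 0 := fun x => le_antisymm (hG0 ▸ le_iSup g x) zero_le
    simp [this]
  set c := (F * G) ^ (1 / 2 : ℝ) with hc
  have hcsq : c ^ 2 = F * G := by
    rw [hc, ← ENNReal.rpow_natCast, ← ENNReal.rpow_mul]
    simp
  have hc0 : c ^ 2 ≠ 0 := by rw [hcsq]; exact mul_ne_zero hF0 hG0
  have hct : c ^ 2 ≠ ⊤ := by rw [hcsq]; exact ENNReal.mul_ne_top hf1 hg1
  have := lintegral_mul_lintegral_le_of_sup_eq_one (f := fun x => F⁻¹ * f x)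
    (g := fun x => G⁻¹ * g x) (h := fun x => c⁻¹ * h x) (by fun_prop) (by fun_prop) (by fun_prop)
    (by rw [← ENNReal.mul_iSup, ← hF, ENNReal.inv_mul_cancel hF0 hf1])
    (by rw [← ENNReal.mul_iSup, ← hG, ENNReal.inv_mul_cancel hG0 hg1])
    (by
      intro x y
      rw [mul_pow, ← ENNReal.inv_pow, hcsq, ENNReal.mul_inv (Or.inl hF0) (Or.inl hf1),
        mul_mul_mul_comm]
      gcongr
      exact H x y)
  rw [lintegral_const_mul _ hf, lintegral_const_mul _ hg, lintegral_const_mul _ hh,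
    mul_mul_mul_comm, ← ENNReal.mul_inv (Or.inl hF0) (Or.inl hf1), mul_pow, ← ENNReal.inv_pow,
    ← hcsq] at this
  exact (ENNReal.mul_le_mul_iff_right (ENNReal.inv_ne_zero.2 hct) (ENNReal.inv_ne_top.2 hc0)).1 this

lemma lintegral_eq_iSup_lintegral_min {α : Type*} [MeasurableSpace α] {μ : Measure α}
    {f : α → ℝ≥0∞} (hf : Measurable f) :
    ∫⁻ x, f x ∂μ = ⨆ N : ℕ, ∫⁻ x, min (f x) N ∂μ := by
  rw [← lintegral_iSup (fun N => hf.min measurable_const)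
    (fun N M hNM x => min_le_min le_rfl (by exact_mod_cast hNM))]
  congr with x
  rw [← inf_iSup_eq, ENNReal.iSup_natCast]
  simp

/-- One-dimensional Prékopa-Leindler inequality, for midpoints. -/
lemma prekopaLeindler_real {f g h : ℝ → ℝ≥0∞} (hf : Measurable f)
    (hg : Measurable g) (hh : Measurable h)
    (H : ∀ x y, f x * g y ≤ h ((2 : ℝ)⁻¹ • (x + y)) ^ 2) :
    (∫⁻ x, f x) * (∫⁻ x, g x) ≤ (∫⁻ x, h x) ^ 2 := by
  rw [lintegral_eq_iSup_lintegral_min hf, lintegral_eq_iSup_lintegral_min hg, ENNReal.iSup_mul]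
  refine iSup_le fun N => ?_
  rw [ENNReal.mul_iSup]
  refine iSup_le fun M => ?_
  refine lintegral_mul_lintegral_le_of_bdd (hf.min measurable_const) (hg.min measurable_const) hh
    ?_ ?_ fun x y => le_trans (mul_le_mul' (min_le_left _ _) (min_le_left _ _)) (H x y)
  · exact ne_top_of_le_ne_top (ENNReal.natCast_ne_top N) (iSup_le fun x => min_le_right _ _)
  · exact ne_top_of_le_ne_top (ENNReal.natCast_ne_top M) (iSup_le fun x => min_le_right _ _)

/-- Prékopa-Leindler inequality on `ℝⁿ`, for midpoints. -/
lemma prekopaLeindler_pi (n : ℕ) : ∀ {f g h : (Fin n → ℝ) → ℝ≥0∞}, Measurable f →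
    Measurable g → Measurable h → (∀ x y, f x * g y ≤ h ((2 : ℝ)⁻¹ • (x + y)) ^ 2) →
    (∫⁻ x, f x) * (∫⁻ x, g x) ≤ (∫⁻ x, h x) ^ 2 := by
  induction n with
  | zero =>
    intro f g h hf hg hh H
    rw [Measure.volume_pi_eq_dirac 0, lintegral_dirac, lintegral_dirac, lintegral_dirac]
    simpa using H 0 0
  | succ n ih =>
    intro f g h hf hg hh H
    let e := (MeasurableEquiv.piFinSuccAbove (fun _ : Fin (n + 1) => ℝ) 0).symm
    have he : MeasurePreserving e volume volume :=
      (volume_preserving_piFinSuccAbove (fun _ : Fin (n + 1) => ℝ) 0).symm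
    have key : ∀ {f : (Fin (n + 1) → ℝ) → ℝ≥0∞}, Measurable f →
        ∫⁻ x, f x = ∫⁻ s : ℝ, ∫⁻ v : Fin n → ℝ, f (e (s, v)) := by
      intro f hf
      rw [← he.lintegral_comp hf]
      exact lintegral_prod _ (hf.comp e.measurable).aemeasurable
    have hmeas : ∀ {f : (Fin (n + 1) → ℝ) → ℝ≥0∞}, Measurable f →
        Measurable fun s : ℝ => ∫⁻ v : Fin n → ℝ, f (e (s, v)) := fun hf =>
      (hf.comp e.measurable).lintegral_prod_right'
    have hsec : ∀ {f : (Fin (n + 1) → ℝ) → ℝ≥0∞}, Measurable f → ∀ s : ℝ,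
        Measurable fun v : Fin n → ℝ => f (e (s, v)) := fun hf s =>
      (hf.comp e.measurable).comp measurable_prodMk_left
    rw [key hf, key hg, key hh]
    refine prekopaLeindler_real (hmeas hf) (hmeas hg) (hmeas hh) fun s t => ?_
    refine ih (hsec hf s) (hsec hg t) (hsec hh _) fun v w => ?_
    convert H (e (s, v)) (e (t, w)) using 3
    ext i
    refine Fin.cases ?_ (fun j => ?_) i <;> simp [e, mul_add]

/-- Multiplicative Brunn-Minkowski inequality for midpoints. -/
lemma volume_mul_volume_le_of_midpoint_mem {n : ℕ} {A B D : Set (EuclideanSpace ℝ (Fin n))}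
    (hA : MeasurableSet A) (hB : MeasurableSet B) (hD : MeasurableSet D)
    (h : ∀ a ∈ A, ∀ b ∈ B, (2 : ℝ)⁻¹ • (a + b) ∈ D) :
    volume A * volume B ≤ volume D ^ 2 := by
  let φ := @WithLp.toLp 2 (Fin n → ℝ)
  have hφ : MeasurePreserving φ := PiLp.volume_preserving_toLp (Fin n)
  rw [← hφ.measure_preimage hA.nullMeasurableSet, ← hφ.measure_preimage hB.nullMeasurableSet,
    ← hφ.measure_preimage hD.nullMeasurableSet,
    ← lintegral_indicator_one (hφ.measurable hA), ← lintegral_indicator_one (hφ.measurable hB),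
    ← lintegral_indicator_one (hφ.measurable hD)]
  refine prekopaLeindler_pi n (measurable_one.indicator (hφ.measurable hA))
    (measurable_one.indicator (hφ.measurable hB)) (measurable_one.indicator (hφ.measurable hD))
    fun x y => ?_
  by_cases hx : x ∈ φ ⁻¹' A
  · by_cases hy : y ∈ φ ⁻¹' B
    · have : (2 : ℝ)⁻¹ • (x + y) ∈ φ ⁻¹' D := h _ hx _ hy
      rw [Set.indicator_of_mem hx, Set.indicator_of_mem hy, Set.indicator_of_mem this]
      simp
    · simp [hy]
  · simp [hx]

/-- A random variable whose tails contract under `T ↦ 2 * T + a` has controlled fourth moment. -/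
lemma integral_max_pow_four_le {Ω : Type*} [MeasurableSpace Ω] {μ : Measure Ω}
    [IsProbabilityMeasure μ] {h : Ω → ℝ} (hh : Measurable h) {R a : ℝ}
    (hR : ∀ᵐ x ∂μ, |h x| ≤ R) (ha : 0 ≤ a)
    (H : ∀ T, a ≤ T → μ.real {x | 2 * T + a < h x} ≤ μ.real {x | T < h x} / 399) :
    Integrable (fun x => max (h x) a ^ 4) μ ∧ ∫ x, max (h x) a ^ 4 ∂μ ≤ 102 * a ^ 4 := by
  have hXint : Integrable (fun x => max (h x) a ^ 4) μ := by
    refine Integrable.of_bound (by fun_prop) ((max R a) ^ 4) ?_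
    filter_upwards [hR] with x hx
    rw [Real.norm_of_nonneg (by positivity)]
    gcongr
    exact (le_abs_self _).trans hx
  refine ⟨hXint, ?_⟩
  set M : Ω → ℝ := fun x => max ((h x - a) / 2) a with hM
  have hle : ∀ x, max (h x) a ≤ 3 * M x := by
    intro x
    refine max_le ?_ ?_
    · have h1 := le_max_left ((h x - a) / 2) a
      have h2 := le_max_right ((h x - a) / 2) a
      simp only [hM]; linarith
    · have h2 := le_max_right ((h x - a) / 2) a
      simp only [hM]; linarith
  have h1 : ENNReal.ofReal (∫ x, max (h x) a ^ 4 ∂μ)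
      ≤ 81 * ∫⁻ x, ENNReal.ofReal (M x ^ 4) ∂μ := by
    rw [ofReal_integral_eq_lintegral_ofReal hXint (Filter.Eventually.of_forall fun x => by positivity),
      ← lintegral_const_mul' _ _ (by simp)]
    refine lintegral_mono fun x => ?_
    rw [← ENNReal.ofReal_ofNat, ← ENNReal.ofReal_mul (by norm_num)]
    refine ENNReal.ofReal_le_ofReal ?_
    calc max (h x) a ^ 4 ≤ (3 * M x) ^ 4 := by
          gcongr
          exact hle x
      _ = 81 * M x ^ 4 := by ring
  have h2 : ∫⁻ x, ENNReal.ofReal (M x ^ 4) ∂μ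
      ≤ ENNReal.ofReal (a ^ 4) + ENNReal.ofReal (1 / 399) *
        ENNReal.ofReal (∫ x, max (h x) a ^ 4 ∂μ) := by
    rw [ofReal_integral_eq_lintegral_ofReal hXint (Filter.Eventually.of_forall fun x => by positivity),
      lintegral_eq_lintegral_meas_lt μ (Filter.Eventually.of_forall fun x => by positivity)
        (by fun_prop),
      lintegral_eq_lintegral_meas_lt μ (Filter.Eventually.of_forall fun x => by positivity)
        (by fun_prop),
      ← lintegral_const_mul' _ _ (by simp)]
    have h3 : ENNReal.ofReal (a ^ 4)
        = ∫⁻ t in Set.Ioi (0 : ℝ), (Set.Iic (a ^ 4)).indicator 1 t := by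
      rw [lintegral_indicator_one measurableSet_Iic, Measure.restrict_apply measurableSet_Iic,
        Set.inter_comm, Set.Ioi_inter_Iic, Real.volume_Ioc, sub_zero]
    rw [h3, ← lintegral_add_left (measurable_one.indicator measurableSet_Iic)]
    refine setLIntegral_mono' measurableSet_Ioi fun t ht => ?_
    rcases le_or_gt t (a ^ 4) with hta | hta
    · rw [Set.indicator_of_mem (Set.mem_Iic.2 hta)]
      exact le_trans prob_le_one (by simp)
    · set T := t ^ (1 / 4 : ℝ) with hT
      have hT0 : 0 ≤ T := Real.rpow_nonneg (le_of_lt ht) _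
      have hT4 : T ^ 4 = t := by
        rw [hT, ← Real.rpow_natCast, ← Real.rpow_mul (le_of_lt ht)]
        simp
      have haT : a ≤ T := by
        rw [← hT4] at hta
        exact (lt_of_pow_lt_pow_left₀ 4 hT0 hta).le
      have e1 : {x | t < M x ^ 4} ⊆ {x | 2 * T + a < h x} := by
        intro x hx
        have hx' : T < M x := by
          rw [Set.mem_ofPred_eq, ← hT4] at hx
          exact lt_of_pow_lt_pow_left₀ 4 (ha.trans (le_max_right _ _)) hx
        rcases lt_max_iff.1 hx' with h' | h'
        · simp only [Set.mem_ofPred_eq]; linarith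
        · linarith
      have e2 : {x | T < h x} ⊆ {x | t < max (h x) a ^ 4} := by
        intro x hx
        rw [Set.mem_ofPred_eq, ← hT4]
        exact pow_lt_pow_left₀ (lt_max_of_lt_left hx) hT0 (by norm_num)
      refine le_add_left ?_
      rw [← ofReal_measureReal, ← ofReal_measureReal, ← ENNReal.ofReal_mul (by norm_num)]
      refine ENNReal.ofReal_le_ofReal ?_
      have := H T haT
      have l1 := measureReal_mono (μ := μ) e1
      have l2 := measureReal_mono (μ := μ) e2
      linarith
  have h4 := h1.trans (mul_le_mul_right h2 81)
  have hnn : 0 ≤ ∫ x, max (h x) a ^ 4 ∂μ := integral_nonneg fun x => by positivity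
  rw [← ENNReal.ofReal_mul (by norm_num), ← ENNReal.ofReal_add (by positivity) (by positivity),
    ← ENNReal.ofReal_ofNat, ← ENNReal.ofReal_mul (by norm_num),
    ENNReal.ofReal_le_ofReal_iff (by positivity)] at h4
  have ha4 : 0 ≤ a ^ 4 := by positivity
  linarith

/-- Linear functionals on a convex body satisfy a reverse Hölder inequality. -/
lemma setIntegral_inner_pow_four_le {n : ℕ} {C : Set (EuclideanSpace ℝ (Fin n))}
    (hconv : Convex ℝ C) (hcomp : IsCompact C) (hvol : volume C = 1)
    {L : ℝ} (hL : 0 < L) (ξ : EuclideanSpace ℝ (Fin n))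
    (hξ : ∫ x in C, ⟪x, ξ⟫ ^ 2 = L ^ 2) :
    ∫ x in C, ⟪x, ξ⟫ ^ 4 ≤ 32640000 * L ^ 4 := by
  have hCm : MeasurableSet C := hcomp.measurableSet
  have : IsProbabilityMeasure (volume.restrict C) := ⟨by simp [hvol]⟩
  obtain ⟨R, hR⟩ : ∃ R, ∀ x ∈ C, |⟪x, ξ⟫| ≤ R :=
    hcomp.exists_bound_of_continuousOn (f := fun x => ⟪x, ξ⟫) (by fun_prop)
  have main : ∀ η : EuclideanSpace ℝ (Fin n), (∀ x, ⟪x, η⟫ ^ 2 = ⟪x, ξ⟫ ^ 2) →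
      Integrable (fun x => max ⟪x, η⟫ (20 * L) ^ 4) (volume.restrict C) ∧
      ∫ x in C, max ⟪x, η⟫ (20 * L) ^ 4 ≤ 102 * (20 * L) ^ 4 := by
    intro η hη
    have hcheb := mul_meas_ge_le_integral_of_nonneg (μ := volume.restrict C)
      (f := fun x => ⟪x, η⟫ ^ 2) (Filter.Eventually.of_forall fun x => by positivity)
      (ContinuousOn.integrableOn_compact hcomp (by fun_prop)) ((20 * L) ^ 2)
    simp only [hη, hξ] at hcheb
    have hcheb' : (volume.restrict C).real {x | (20 * L) ^ 2 ≤ ⟪x, η⟫ ^ 2} ≤ 1 / 400 := by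
      simp only [hη]
      have : 0 < L ^ 2 := by positivity
      nlinarith
    refine integral_max_pow_four_le (by fun_prop) (R := R) ?_ (by positivity) ?_
    · filter_upwards [ae_restrict_mem hCm] with x hx
      exact (sq_eq_sq_iff_abs_eq_abs _ _).1 (hη x) ▸ hR x hx
    intro T hT
    set A := {x : EuclideanSpace ℝ (Fin n) | 2 * T + 20 * L < ⟪x, η⟫} with hA
    set D := {x : EuclideanSpace ℝ (Fin n) | T < ⟪x, η⟫} with hD
    set B := {x : EuclideanSpace ℝ (Fin n) | |⟪x, η⟫| < 20 * L} with hB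
    have hAm : MeasurableSet A := measurableSet_lt (by fun_prop) (by fun_prop)
    have hDm : MeasurableSet D := measurableSet_lt (by fun_prop) (by fun_prop)
    have hBm : MeasurableSet B := measurableSet_lt (by fun_prop) (by fun_prop)
    have hbm : volume (A ∩ C) * volume (B ∩ C) ≤ volume (D ∩ C) ^ 2 := by
      refine volume_mul_volume_le_of_midpoint_mem (hAm.inter hCm) (hBm.inter hCm)
        (hDm.inter hCm) ?_
      rintro x ⟨hxA, hxC⟩ y ⟨hyB, hyC⟩
      constructor
      · have h1 : 2 * T + 20 * L < ⟪x, η⟫ := hxA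
        have h2 : |⟪y, η⟫| < 20 * L := hyB
        simp only [hD, Set.mem_ofPred_eq, inner_smul_left, inner_add_left]
        have := (abs_lt.1 h2).1
        simp
        linarith
      · rw [smul_add]
        exact hconv hxC hyC (by norm_num) (by norm_num) (by norm_num)
    rw [← Measure.restrict_apply hAm, ← Measure.restrict_apply hBm, ← Measure.restrict_apply hDm,
      ← ofReal_measureReal, ← ofReal_measureReal, ← ofReal_measureReal,
      ← ENNReal.ofReal_mul measureReal_nonneg, ← ENNReal.ofReal_pow measureReal_nonneg,
      ENNReal.ofReal_le_ofReal_iff (by positivity)] at hbm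
    have hDle : (volume.restrict C).real D ≤ 1 / 400 := by
      refine (measureReal_mono fun x hx => ?_).trans hcheb'
      have hx' : T < ⟪x, η⟫ := hx
      have h0 : (0 : ℝ) ≤ 20 * L := by positivity
      exact pow_le_pow_left₀ h0 (by linarith) 2
    have hBge : 399 / 400 ≤ (volume.restrict C).real B := by
      have hc := probReal_compl_eq_one_sub (μ := volume.restrict C) hBm
      have : (volume.restrict C).real Bᶜ ≤ 1 / 400 := by
        refine (measureReal_mono fun x hx => ?_).trans hcheb'
        have hx' : 20 * L ≤ |⟪x, η⟫| := not_lt.1 hx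
        have h0 : (0 : ℝ) ≤ 20 * L := by positivity
        rw [Set.mem_ofPred_eq, ← sq_abs ⟪x, η⟫]
        exact pow_le_pow_left₀ h0 hx' 2
      linarith
    have hA0 : 0 ≤ (volume.restrict C).real A := measureReal_nonneg
    have hD0 : 0 ≤ (volume.restrict C).real D := measureReal_nonneg
    nlinarith
  obtain ⟨i1, m1⟩ := main ξ fun _ => rfl
  obtain ⟨i2, m2⟩ := main (-ξ) fun x => by rw [inner_neg_right, neg_sq]
  calc ∫ x in C, ⟪x, ξ⟫ ^ 4
      ≤ ∫ x in C, (max ⟪x, ξ⟫ (20 * L) ^ 4 + max ⟪x, -ξ⟫ (20 * L) ^ 4) := by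
        refine integral_mono_of_nonneg (Filter.Eventually.of_forall fun x => by positivity)
          (i1.add i2) (Filter.Eventually.of_forall fun x => ?_)
        have p1 : 0 ≤ max ⟪x, ξ⟫ (20 * L) ^ 4 := by positivity
        have p2 : 0 ≤ max ⟪x, -ξ⟫ (20 * L) ^ 4 := by positivity
        simp only
        rcases le_total 0 ⟪x, ξ⟫ with h | h
        · have := pow_le_pow_left₀ h (le_max_left ⟪x, ξ⟫ (20 * L)) 4
          linarith
        · have := pow_le_pow_left₀ (a := ⟪x, -ξ⟫) (by rw [inner_neg_right]; linarith)
            (le_max_left ⟪x, -ξ⟫ (20 * L)) 4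
          have e : ⟪x, -ξ⟫ ^ 4 = ⟪x, ξ⟫ ^ 4 := by rw [inner_neg_right]; ring
          linarith
    _ = (∫ x in C, max ⟪x, ξ⟫ (20 * L) ^ 4) + ∫ x in C, max ⟪x, -ξ⟫ (20 * L) ^ 4 :=
        integral_add i1 i2
    _ ≤ 102 * (20 * L) ^ 4 + 102 * (20 * L) ^ 4 := add_le_add m1 m2
    _ = 32640000 * L ^ 4 := by ring

lemma integrable_pow_of_ae_abs_le {Ω : Type*} [MeasurableSpace Ω] {μ : Measure Ω}
    [IsFiniteMeasure μ] {X : Ω → ℝ} (hX : Measurable X) {R : ℝ} (hR : ∀ᵐ x ∂μ, |X x| ≤ R) (k : ℕ) :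
    Integrable (fun x => X x ^ k) μ := by
  refine Integrable.of_bound (by fun_prop) (R ^ k) ?_
  filter_upwards [hR] with x hx
  rw [norm_pow]
  exact pow_le_pow_left₀ (norm_nonneg _) hx k

/-- Second and fourth moments of sums of independent centered random variables. -/
lemma moments_sum_of_iIndepFun {Ω ι : Type*} [MeasurableSpace Ω] {μ : Measure Ω}
    [IsProbabilityMeasure μ] {X : ι → Ω → ℝ} (hind : ProbabilityTheory.iIndepFun X μ)
    (hX : ∀ i, Measurable (X i)) {R : ι → ℝ} (hR : ∀ i, ∀ᵐ x ∂μ, |X i x| ≤ R i)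
    {v : ι → ℝ} {K : ℝ} (hK : 3 ≤ K) (hv : ∀ i, 0 ≤ v i)
    (h1 : ∀ i, ∫ x, X i x ∂μ = 0) (h2 : ∀ i, ∫ x, X i x ^ 2 ∂μ = v i)
    (h4 : ∀ i, ∫ x, X i x ^ 4 ∂μ ≤ K * v i ^ 2) (F : Finset ι) :
    ∫ x, (∑ i ∈ F, X i x) ∂μ = 0 ∧ ∫ x, (∑ i ∈ F, X i x) ^ 2 ∂μ = ∑ i ∈ F, v i ∧
      ∫ x, (∑ i ∈ F, X i x) ^ 4 ∂μ ≤ K * (∑ i ∈ F, v i) ^ 2 := by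
  classical
  induction F using Finset.induction_on with
  | empty => simp
  | insert j F hj ih =>
    obtain ⟨i1, i2, i4⟩ := ih
    set S : Ω → ℝ := fun x => ∑ i ∈ F, X i x with hS
    have hSm : Measurable S := by fun_prop
    have hSb : ∀ᵐ x ∂μ, |S x| ≤ ∑ i ∈ F, R i := by
      have : ∀ᵐ x ∂μ, ∀ i ∈ F, |X i x| ≤ R i := by
        rw [Filter.eventually_all_finset]
        exact fun i _ => hR i
      filter_upwards [this] with x hx
      exact (Finset.abs_sum_le_sum_abs _ _).trans (Finset.sum_le_sum hx)
    have hSX : ProbabilityTheory.IndepFun S (X j) μ := by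
      have := hind.indepFun_finsetSum_of_notMem hX hj
      convert this using 1
      ext x
      simp [hS]
    have hprod : ∀ k l : ℕ, ∫ x, S x ^ k * X j x ^ l ∂μ
        = (∫ x, S x ^ k ∂μ) * ∫ x, X j x ^ l ∂μ := fun k l =>
      (hSX.comp (measurable_id.pow_const k) (measurable_id.pow_const l)
        ).integral_fun_mul_eq_mul_integral (hSm.pow_const k).aestronglyMeasurable
          ((hX j).pow_const l).aestronglyMeasurable
    have hSi := integrable_pow_of_ae_abs_le hSm hSb
    have hXi := integrable_pow_of_ae_abs_le (hX j) (hR j)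
    have h_int : ∀ k l : ℕ, Integrable (fun x => S x ^ k * X j x ^ l) μ := fun k l =>
      (hSX.comp (measurable_id.pow_const k) (measurable_id.pow_const l)
        ).integrable_mul (hSi k) (hXi l)
    have p11 := hprod 1 1
    have p12 := hprod 1 3
    have p31 := hprod 3 1
    have p22 := hprod 2 2
    have n11 := h_int 1 1
    have n13 := h_int 1 3
    have n31 := h_int 3 1
    have n22 := h_int 2 2
    have hS1 := hSi 1
    have hX1 := hXi 1
    simp only [pow_one, h1, i1, zero_mul, mul_zero, h2] at p11 p12 p31 p22 n11 n13 n31 n22 hS1 hX1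
    simp only [Finset.sum_insert hj]
    refine ⟨?_, ?_, ?_⟩
    · change ∫ x, (X j x + S x) ∂μ = 0
      rw [integral_add hX1 hS1, h1, i1, add_zero]
    · have e : ∀ x, (X j x + S x) ^ 2 = X j x ^ 2 + (S x ^ 2 + 2 * (S x * X j x)) := fun x => by ring
      change ∫ x, (X j x + S x) ^ 2 ∂μ = _
      simp only [e]
      have a1 : Integrable (fun x => S x ^ 2 + 2 * (S x * X j x)) μ :=
        (hSi 2).add (n11.const_mul 2)
      rw [integral_add (hXi 2) a1,
        integral_add (hSi 2) (n11.const_mul 2), integral_const_mul, p11, h2, i2]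
      ring
    · have e : ∀ x, (X j x + S x) ^ 4 = X j x ^ 4 + (S x ^ 4 + (6 * (S x ^ 2 * X j x ^ 2) +
          (4 * (S x * X j x ^ 3) + 4 * (S x ^ 3 * X j x)))) := fun x => by ring
      change ∫ x, (X j x + S x) ^ 4 ∂μ ≤ _
      simp only [e]
      have a1 : Integrable (fun x => 4 * (S x * X j x ^ 3) + 4 * (S x ^ 3 * X j x)) μ :=
        (n13.const_mul 4).add (n31.const_mul 4)
      have a2 : Integrable (fun x => 6 * (S x ^ 2 * X j x ^ 2) +
          (4 * (S x * X j x ^ 3) + 4 * (S x ^ 3 * X j x))) μ := (n22.const_mul 6).add a1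
      have a3 : Integrable (fun x => S x ^ 4 + (6 * (S x ^ 2 * X j x ^ 2) +
          (4 * (S x * X j x ^ 3) + 4 * (S x ^ 3 * X j x)))) μ := (hSi 4).add a2
      rw [integral_add (hXi 4) a3, integral_add (hSi 4) a2,
        integral_add (n22.const_mul 6) a1, integral_add (n13.const_mul 4) (n31.const_mul 4),
        integral_const_mul, integral_const_mul, integral_const_mul, p12, p31, p22, i2]
      have hs : 0 ≤ ∑ i ∈ F, v i := Finset.sum_nonneg fun i _ => hv i
      have := h4 j
      nlinarith [mul_nonneg (mul_nonneg (sub_nonneg.2 hK) hs) (hv j)]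

lemma const_mul_sqrt_le_integral_of_moments {Ω : Type*} [MeasurableSpace Ω] {μ : Measure Ω}
    {f : Ω → ℝ} (hf : ∀ x, 0 ≤ f x) (i1 : Integrable f μ) (i2 : Integrable (fun x => f x ^ 2) μ)
    (i4 : Integrable (fun x => f x ^ 4) μ) {m : ℝ} (hm : 0 ≤ m)
    (h2 : ∫ x, f x ^ 2 ∂μ = m ^ 2) (h4 : ∫ x, f x ^ 4 ∂μ ≤ 32640000 * m ^ 4) :
    1 / 20000 * m ≤ ∫ x, f x ∂μ := by
  rcases hm.eq_or_lt with rfl | hm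
  · simpa using integral_nonneg hf
  have hpt : ∀ x, 1 / (10000 * m) * f x ^ 2 - 1 / (10000 * m) ^ 3 * f x ^ 4 ≤ f x := by
    intro x
    set u := f x / (10000 * m) with hu
    have hfu : f x = 10000 * m * u := by rw [hu]; field_simp
    have hu0 : 0 ≤ u := by have := hf x; positivity
    have : u ^ 2 - u ^ 4 ≤ u := by
      have h' : 0 ≤ 1 - u + u ^ 3 := by
        nlinarith [sq_nonneg (u - 1 / 2), sq_nonneg (u - 3 / 5), mul_nonneg hu0 (sq_nonneg (u - 3 / 5))]
      nlinarith [mul_nonneg hu0 h']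
    rw [hfu]
    calc _ = 10000 * m * (u ^ 2 - u ^ 4) := by field_simp
      _ ≤ _ := by gcongr
  have hI := integral_mono ((i2.const_mul (1 / (10000 * m))).sub
    (i4.const_mul (1 / (10000 * m) ^ 3))) i1 hpt
  simp only [Pi.sub_apply] at hI
  rw [integral_sub (i2.const_mul _) (i4.const_mul _), integral_const_mul, integral_const_mul,
    h2] at hI
  refine le_trans ?_ hI
  have : 1 / (10000 * m) ^ 3 * ∫ x, f x ^ 4 ∂μ ≤ 1 / (10000 * m) ^ 3 * (32640000 * m ^ 4) := by
    gcongr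
  refine le_trans ?_ (sub_le_sub_left this _)
  have e : 1 / (10000 * m) * m ^ 2 - 1 / (10000 * m) ^ 3 * (32640000 * m ^ 4)
      = (1 / 10000 - 32640000 / 10000 ^ 3) * m := by field_simp
  rw [e]
  gcongr
  norm_num

lemma integrable_pi_of_continuous {n s : ℕ} {C : Set (EuclideanSpace ℝ (Fin n))}
    (hcomp : IsCompact C) {f : (Fin s → EuclideanSpace ℝ (Fin n)) → ℝ} (hf : Continuous f) :
    Integrable f (Measure.pi fun _ => volume.restrict C) := by
  rw [← Measure.restrict_pi_pi]
  exact hf.continuousOn.integrableOn_compact (isCompact_univ_pi fun _ => hcomp)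

/-- A linear combination of independent random vectors in an isotropic convex body has Euclidean
norm of expected order `L_C √n ‖t‖₂`. -/
lemma le_integral_norm_sum {n s : ℕ} {C : Set (EuclideanSpace ℝ (Fin n))}
    (hC : IsConvexBody C) {L : ℝ} (hiso : IsIsotropic C L) (t : Fin s → ℝ) :
    1 / 20000 * (√n * L * euclNorm t)
      ≤ ∫ x, ‖∑ j, t j • x j‖ ∂(Measure.pi fun _ : Fin s => volume.restrict C) := by
  obtain ⟨hconv, hcomp, -⟩ := hC
  obtain ⟨hvol, hbar, hL, hmom⟩ := hiso
  have : IsProbabilityMeasure (volume.restrict C) := ⟨by simp [hvol]⟩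
  set ν := Measure.pi fun _ : Fin s => volume.restrict C with hν
  set Y : (Fin s → EuclideanSpace ℝ (Fin n)) → EuclideanSpace ℝ (Fin n) :=
    fun x => ∑ j, t j • x j with hY
  have hYc : Continuous Y := by fun_prop
  have hτ : euclNorm t ^ 2 = ∑ j, t j ^ 2 := Real.sq_sqrt (Finset.sum_nonneg fun j _ => sq_nonneg _)
  obtain ⟨R, hR⟩ := hcomp.exists_bound_of_continuousOn
    (f := fun x : EuclideanSpace ℝ (Fin n) => x) (by fun_prop)
  have hcoord : ∀ i : Fin n, ∫ x, Y x i ^ 2 ∂ν = L ^ 2 * euclNorm t ^ 2 ∧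
      ∫ x, Y x i ^ 4 ∂ν ≤ 32640000 * (L ^ 2 * euclNorm t ^ 2) ^ 2 := by
    intro i
    have hin : ∀ x : EuclideanSpace ℝ (Fin n), ⟪x, EuclideanSpace.single i (1 : ℝ)⟫ = x i := by
      intro x
      rw [EuclideanSpace.inner_single_right]
      simp
    have hsq : ∫ x in C, x i ^ 2 = L ^ 2 := by
      simpa only [hin] using hmom (EuclideanSpace.single i 1) (by simp)
    have h4 : ∫ x in C, x i ^ 4 ≤ 32640000 * L ^ 4 := by
      simpa only [hin] using setIntegral_inner_pow_four_le hconv hcomp hvol hL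
        (EuclideanSpace.single i 1) (by simpa only [hin] using hsq)
    have h1 : ∫ x in C, x i = 0 := by
      have := integral_inner (𝕜 := ℝ) (μ := volume.restrict C)
        (f := fun x : EuclideanSpace ℝ (Fin n) => x)
        (ContinuousOn.integrableOn_compact hcomp (by fun_prop)) (EuclideanSpace.single i 1)
      rw [hbar, inner_zero_right] at this
      rw [← this]
      refine integral_congr_ae (Filter.Eventually.of_forall fun x => ?_)
      simp only
      rw [real_inner_comm, hin]
    have key := moments_sum_of_iIndepFun (μ := ν) (K := 32640000)
      (X := fun j x => t j * x j i) (v := fun j => t j ^ 2 * L ^ 2) (R := fun j => |t j| * R)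
      (ProbabilityTheory.iIndepFun_pi (μ := fun _ : Fin s => volume.restrict C)
        (X := fun j (y : EuclideanSpace ℝ (Fin n)) => t j * y i) fun j => by fun_prop)
      (fun j => by fun_prop) ?_ (by norm_num) (fun j => by positivity) ?_ ?_ ?_ Finset.univ
    · have hYi : ∀ x, Y x i = ∑ j, t j * x j i := by
        intro x
        simp [hY]
      simp only [hYi]
      refine ⟨key.2.1.trans ?_, key.2.2.trans (le_of_eq ?_)⟩
      · rw [hτ, ← Finset.sum_mul, mul_comm]
      · rw [hτ, ← Finset.sum_mul, mul_comm (L ^ 2)]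
    · intro j
      have : ∀ᵐ y ∂(volume.restrict C), |t j * y i| ≤ |t j| * R := by
        filter_upwards [ae_restrict_mem hcomp.measurableSet] with y hy
        rw [abs_mul]
        gcongr
        exact (PiLp.norm_apply_le y i).trans (hR y hy)
      exact (measurePreserving_eval (fun _ : Fin s => volume.restrict C) j
        ).quasiMeasurePreserving.ae this
    · intro j
      rw [integral_comp_eval (μ := fun _ : Fin s => volume.restrict C) (i := j)
        (f := fun y : EuclideanSpace ℝ (Fin n) => t j * y i)
        (Measurable.aestronglyMeasurable (by fun_prop)), integral_const_mul, h1, mul_zero]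
    · intro j
      rw [integral_comp_eval (μ := fun _ : Fin s => volume.restrict C) (i := j)
        (f := fun y : EuclideanSpace ℝ (Fin n) => (t j * y i) ^ 2)
        (Measurable.aestronglyMeasurable (by fun_prop))]
      simp only [mul_pow]
      rw [integral_const_mul, hsq]
    · intro j
      rw [integral_comp_eval (μ := fun _ : Fin s => volume.restrict C) (i := j)
        (f := fun y : EuclideanSpace ℝ (Fin n) => (t j * y i) ^ 4)
        (Measurable.aestronglyMeasurable (by fun_prop))]
      simp only [mul_pow]
      rw [integral_const_mul]
      have ht4 : 0 ≤ t j ^ 4 := by positivity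
      nlinarith [mul_le_mul_of_nonneg_left h4 ht4]
  have h_int : ∀ {f : (Fin s → EuclideanSpace ℝ (Fin n)) → ℝ}, Continuous f → Integrable f ν :=
    fun hf => integrable_pi_of_continuous hcomp hf
  have hnorm : ∀ x, ‖Y x‖ ^ 2 = ∑ i, Y x i ^ 2 := fun x => EuclideanSpace.real_norm_sq_eq _
  refine const_mul_sqrt_le_integral_of_moments (fun x => norm_nonneg _) (h_int (by fun_prop))
    (h_int (by fun_prop)) (h_int (by fun_prop))
    (mul_nonneg (mul_nonneg (Real.sqrt_nonneg _) hL.le) (Real.sqrt_nonneg _)) ?_ ?_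
  · change ∫ x, ‖Y x‖ ^ 2 ∂ν = _
    simp only [hnorm]
    rw [integral_finsetSum _ fun i _ => h_int (by fun_prop)]
    simp only [(hcoord _).1, Finset.sum_const, Finset.card_univ, Fintype.card_fin, nsmul_eq_mul,
      mul_pow, Real.sq_sqrt (Nat.cast_nonneg n)]
    ring
  · calc ∫ x, ‖Y x‖ ^ 4 ∂ν ≤ ∫ x, (n : ℝ) * ∑ i, Y x i ^ 4 ∂ν := by
          refine integral_mono (h_int (by fun_prop)) (h_int (by fun_prop)) fun x => ?_
          have := sq_sum_le_card_mul_sum_sq (s := Finset.univ) (f := fun i => Y x i ^ 2)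
          simp only [Finset.card_univ, Fintype.card_fin, ← pow_mul, ← hnorm] at this
          exact this
      _ = n * ∑ i, ∫ x, Y x i ^ 4 ∂ν := by
          rw [integral_const_mul, integral_finsetSum _ fun i _ => h_int (by fun_prop)]
      _ ≤ n * ∑ i : Fin n, 32640000 * (L ^ 2 * euclNorm t ^ 2) ^ 2 := by
          gcongr with i
          exact (hcoord i).2
      _ = 32640000 * (√n * L * euclNorm t) ^ 4 := by
          have : √(n : ℝ) ^ 4 = n * n := by
            rw [show (4 : ℕ) = 2 * 2 from rfl, pow_mul, Real.sq_sqrt (Nat.cast_nonneg n), sq]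
          simp only [Finset.sum_const, Finset.card_univ, Fintype.card_fin, nsmul_eq_mul, mul_pow,
            this]
          ring

open scoped Pointwise in
/-- Linear isometries preserve the surface measure of the unit sphere. -/
lemma measurePreserving_toSphere {n : ℕ}
    (U : EuclideanSpace ℝ (Fin n) ≃ₗᵢ[ℝ] EuclideanSpace ℝ (Fin n)) :
    MeasurePreserving
      (fun ξ : Metric.sphere (0 : EuclideanSpace ℝ (Fin n)) 1 =>
        (⟨U ξ, by simp⟩ : Metric.sphere (0 : EuclideanSpace ℝ (Fin n)) 1))
      (volume : Measure (EuclideanSpace ℝ (Fin n))).toSphere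
      (volume : Measure (EuclideanSpace ℝ (Fin n))).toSphere := by
  have hm : Measurable (fun ξ : Metric.sphere (0 : EuclideanSpace ℝ (Fin n)) 1 =>
      (⟨U ξ, by simp⟩ : Metric.sphere (0 : EuclideanSpace ℝ (Fin n)) 1)) :=
    Continuous.measurable (by fun_prop)
  refine ⟨hm, Measure.ext fun s hs => ?_⟩
  rw [Measure.map_apply hm hs, Measure.toSphere_apply' _ (hm hs), Measure.toSphere_apply' _ hs]
  congr 1
  rw [← U.measurePreserving.measure_preimage_emb U.toMeasurableEquiv.measurableEmbedding
    (Set.Ioo (0 : ℝ) 1 • (Subtype.val '' s))]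
  congr 1
  ext x
  simp only [Set.mem_smul, Set.mem_image, Set.mem_preimage]
  constructor
  · rintro ⟨r, hr, _, ⟨ξ, hξ, rfl⟩, rfl⟩
    exact ⟨r, hr, _, ⟨_, hξ, rfl⟩, by simp⟩
  · rintro ⟨r, hr, _, ⟨ξ, hξ, rfl⟩, h⟩
    refine ⟨r, hr, U.symm ξ, ⟨⟨U.symm ξ, by simp⟩, by simpa using hξ, rfl⟩, ?_⟩
    apply U.injective
    simp [h]

lemma continuousStar_clm (n : ℕ) :
    ContinuousStar (EuclideanSpace ℝ (Fin n) →L[ℝ] EuclideanSpace ℝ (Fin n)) :=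
  ⟨ContinuousLinearMap.adjoint.continuous⟩

/-- The orthogonal group is compact. -/
lemma compactSpace_unitary (n : ℕ) :
    CompactSpace (unitary (EuclideanSpace ℝ (Fin n) →L[ℝ] EuclideanSpace ℝ (Fin n))) := by
  have : ProperSpace (EuclideanSpace ℝ (Fin n) →L[ℝ] EuclideanSpace ℝ (Fin n)) :=
    FiniteDimensional.proper ℝ _
  have := continuousStar_clm n
  refine isCompact_iff_compactSpace.1 (Metric.isCompact_of_isClosed_isBounded isClosed_unitary ?_)
  refine (Metric.isBounded_closedBall (x := 0) (r := 1)).subset fun u hu => ?_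
  rw [mem_closedBall_zero_iff]
  refine ContinuousLinearMap.opNorm_le_bound _ zero_le_one fun x => ?_
  have := (Unitary.linearIsometryEquiv ⟨u, hu⟩).norm_map x
  rw [one_mul]
  exact this.le

lemma integrable_prod_of_continuous {G X : Type*} [TopologicalSpace G] [CompactSpace G]
    [T2Space G]
    [SecondCountableTopology G] [MeasurableSpace G] [BorelSpace G] [TopologicalSpace X] [T2Space X]
    [MeasurableSpace X] [BorelSpace X] {ν : Measure G} [IsFiniteMeasure ν] {μ : Measure X}
    [SFinite μ] [IsFiniteMeasureOnCompacts μ] {S : Set X} (hS : IsCompact S) {f : G × X → ℝ}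
    (hf : Continuous f) : Integrable f (ν.prod (μ.restrict S)) := by
  have : IsFiniteMeasureOnCompacts (ν.prod μ) := inferInstance
  rw [← Measure.restrict_univ (μ := ν), Measure.prod_restrict]
  exact hf.continuousOn.integrableOn_compact (isCompact_univ.prod hS)

lemma integral_integral_swap_of_continuous {X Y : Type*} [TopologicalSpace X] [CompactSpace X]
    [MeasurableSpace X] [OpensMeasurableSpace X] [TopologicalSpace Y] [CompactSpace Y]
    [MeasurableSpace Y] [OpensMeasurableSpace Y] {μ : Measure X} [IsFiniteMeasure μ]
    {ν : Measure Y} [IsFiniteMeasure ν] {f : X → Y → ℝ} (hf : Continuous f.uncurry) :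
    ∫ x, ∫ y, f x y ∂ν ∂μ = ∫ y, ∫ x, f x y ∂μ ∂ν :=
  integral_integral_swap_of_hasCompactSupport hf (HasCompactSupport.of_compactSpace _)

/-- Averaging a norm over the orthogonal group. -/
lemma integral_gauge_unitary_inv_apply {n : ℕ} [NeZero n]
    [MeasurableSpace (unitary (EuclideanSpace ℝ (Fin n) →L[ℝ] EuclideanSpace ℝ (Fin n)))]
    [BorelSpace (unitary (EuclideanSpace ℝ (Fin n) →L[ℝ] EuclideanSpace ℝ (Fin n)))]
    (ν : Measure (unitary (EuclideanSpace ℝ (Fin n) →L[ℝ] EuclideanSpace ℝ (Fin n))))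
    [IsProbabilityMeasure ν] [ν.IsMulLeftInvariant]
    {K : Set (EuclideanSpace ℝ (Fin n))} (hK : Continuous (gauge K)) (y : EuclideanSpace ℝ (Fin n)) :
    ∫ u, gauge K ((u⁻¹ : unitary (EuclideanSpace ℝ (Fin n) →L[ℝ] EuclideanSpace ℝ (Fin n))).1 y) ∂ν
      = sphereM K * ‖y‖ := by
  have := compactSpace_unitary n
  set A : EuclideanSpace ℝ (Fin n) → ℝ := fun y =>
    ∫ u, gauge K ((u⁻¹ : unitary (EuclideanSpace ℝ (Fin n) →L[ℝ] EuclideanSpace ℝ (Fin n))).1 y) ∂ν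
    with hA
  set τ := (volume : Measure (EuclideanSpace ℝ (Fin n))).toSphere with hτ
  have hinv : ∀ (V : EuclideanSpace ℝ (Fin n) ≃ₗᵢ[ℝ] EuclideanSpace ℝ (Fin n)) y,
      A (V y) = A y := by
    intro V y
    set v := Unitary.linearIsometryEquiv.symm V with hv
    have hVv : V y = v.1 y := by rw [hv]; rfl
    rw [hA]
    simp only
    rw [← integral_mul_left_eq_self _ v]
    congr with u
    rw [hVv, mul_inv_rev]
    congr 1
    change ((u⁻¹ * v⁻¹ * v : unitary (EuclideanSpace ℝ (Fin n) →L[ℝ] _)).1 y) = _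
    rw [inv_mul_cancel_right]
  have hconst : ∀ ξ η : EuclideanSpace ℝ (Fin n), ‖ξ‖ = ‖η‖ → A ξ = A η := by
    intro ξ η h
    rw [← Submodule.reflection_sub h]
    exact (hinv _ _).symm
  have hswap : ∫ ξ, A ξ ∂τ = ∫ ξ, gauge K (ξ : EuclideanSpace ℝ (Fin n)) ∂τ := by
    have hc : Continuous fun p : Metric.sphere (0 : EuclideanSpace ℝ (Fin n)) 1 × unitary
        (EuclideanSpace ℝ (Fin n) →L[ℝ] EuclideanSpace ℝ (Fin n)) => gauge K ((p.2⁻¹).1 p.1) :=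
      hK.comp (Continuous.clm_apply (continuous_subtype_val.comp continuous_snd.inv)
        (continuous_subtype_val.comp continuous_fst))
    have hsw : ∫ ξ, A ξ ∂τ = ∫ u, ∫ ξ : Metric.sphere (0 : EuclideanSpace ℝ (Fin n)) 1,
        gauge K ((u⁻¹).1 ξ) ∂τ ∂ν :=
      integral_integral_swap_of_continuous hc
    rw [hsw]
    have hu : ∀ u : unitary (EuclideanSpace ℝ (Fin n) →L[ℝ] EuclideanSpace ℝ (Fin n)),
        ∫ ξ : Metric.sphere (0 : EuclideanSpace ℝ (Fin n)) 1, gauge K ((u⁻¹).1 ξ) ∂τ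
          = ∫ ξ, gauge K (ξ : EuclideanSpace ℝ (Fin n)) ∂τ := by
      intro u
      have hp := measurePreserving_toSphere (Unitary.linearIsometryEquiv u⁻¹)
      refine (integral_map (f := fun ξ => gauge K (ξ : EuclideanSpace ℝ (Fin n)))
        hp.measurable.aemeasurable
        (hK.comp continuous_subtype_val).aestronglyMeasurable).symm.trans ?_
      rw [hp.map_eq]
    simp [hu]
  have hunit : ∀ ξ : EuclideanSpace ℝ (Fin n), ‖ξ‖ = 1 → A ξ = sphereM K := by
    intro ξ hξ
    have h1 : ∀ η : Metric.sphere (0 : EuclideanSpace ℝ (Fin n)) 1, A η = A ξ := fun η =>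
      hconst _ _ (by rw [hξ, norm_eq_of_mem_sphere])
    have : NeZero τ := ⟨Measure.toSphere_ne_zero _⟩
    rw [sphereM, average_eq, ← hτ, ← hswap]
    simp [h1, measureReal_ne_zero_iff, NeZero.ne]
  change A y = _
  rcases eq_or_ne y 0 with rfl | hy
  · simp [hA]
  · have h0 : ‖y‖ ≠ 0 := norm_ne_zero_iff.2 hy
    have hs : A y = ‖y‖ * A (‖y‖⁻¹ • y) := by
      rw [hA]
      simp only
      rw [← integral_const_mul]
      congr with u
      rw [map_smul, gauge_smul_of_nonneg (by positivity), smul_eq_mul, mul_inv_cancel_left₀ h0]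
    rw [hs, hunit _ (by rw [norm_smul, norm_inv, norm_norm, inv_mul_cancel₀ h0]), mul_comm]

lemma continuous_gauge_of_isSymmConvexBody {n : ℕ} {K : Set (EuclideanSpace ℝ (Fin n))}
    (hK : IsSymmConvexBody K) : Continuous (gauge K) := by
  obtain ⟨hconv, -, ⟨x, hx⟩, hsymm⟩ := hK
  refine continuous_gauge hconv (mem_interior_iff_mem_nhds.1 ?_)
  have hx' : -x ∈ K := by
    rw [hsymm]
    simpa using interior_subset hx
  have := hconv.combo_interior_self_mem_interior hx hx' (a := 1 / 2) (b := 1 / 2) (by norm_num)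
    (by norm_num) (by norm_num)
  simpa using this

lemma setIntegral_pi_image_linearIsometryEquiv {n s : ℕ}
    (U : EuclideanSpace ℝ (Fin n) ≃ₗᵢ[ℝ] EuclideanSpace ℝ (Fin n))
    (C : Set (EuclideanSpace ℝ (Fin n))) (f : (Fin s → EuclideanSpace ℝ (Fin n)) → ℝ) :
    ∫ x in Set.univ.pi fun _ : Fin s => U '' C, f x
      = ∫ x in Set.univ.pi fun _ : Fin s => C, f fun j => U (x j) := by
  have hp : MeasurePreserving (fun (x : Fin s → EuclideanSpace ℝ (Fin n)) j => U (x j)) :=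
    volume_preserving_pi fun _ => U.measurePreserving
  rw [← hp.setIntegral_preimage_emb
    (MeasurableEquiv.piCongrRight fun _ : Fin s => U.toMeasurableEquiv).measurableEmbedding]
  congr 2
  ext x
  simp

/-- there is an absolute constant `c > 0` such that for any isotropic
convex body `C` and any centrally symmetric convex body `K` in `ℝⁿ`, for every `s ≥ 1`
and `t ∈ ℝˢ` there is an orthogonal transformation `U ∈ O(n)` with
`∫_{U(C)}⋯∫_{U(C)} ‖∑ t_j x_j‖_K ≥ c L_C √n M(K) ‖t‖₂`. -/
theorem stmt16 :
    ∃ c : ℝ, 0 < c ∧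
      ∀ (n s : ℕ) (_hs : 1 ≤ s)
        (C : Set (EuclideanSpace ℝ (Fin n))) (_hC : IsConvexBody C)
        (L : ℝ) (_hCiso : IsIsotropic C L)
        (K : Set (EuclideanSpace ℝ (Fin n))) (_hK : IsSymmConvexBody K)
        (t : Fin s → ℝ),
        ∃ U : EuclideanSpace ℝ (Fin n) ≃ₗᵢ[ℝ] EuclideanSpace ℝ (Fin n),
          c * L * Real.sqrt n * sphereM K * euclNorm t
            ≤ ∫ x in Set.univ.pi fun _ : Fin s => U '' C,
                gauge K (∑ j, t j • x j) := by
  refine ⟨1 / 20000, by norm_num, fun n s _ C hC L hiso K hK t => ?_⟩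
  rcases Nat.eq_zero_or_pos n with rfl | hn
  · refine ⟨LinearIsometryEquiv.refl ℝ _, ?_⟩
    simpa using integral_nonneg fun x => gauge_nonneg _
  have : NeZero n := ⟨hn.ne'⟩
  let G := unitary (EuclideanSpace ℝ (Fin n) →L[ℝ] EuclideanSpace ℝ (Fin n))
  have := continuousStar_clm n
  let : MeasurableSpace G := borel G
  have : BorelSpace G := ⟨rfl⟩
  have : CompactSpace G := compactSpace_unitary n
  have : SecondCountableTopology G := EMetric.secondCountable_of_sigmaCompact G
  let ν : Measure G := Measure.haarMeasure ⊤
  have : IsProbabilityMeasure ν := ⟨Measure.haarMeasure_self⟩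
  have hcont := continuous_gauge_of_isSymmConvexBody hK
  set S : Set (Fin s → EuclideanSpace ℝ (Fin n)) := Set.univ.pi fun _ => C with hS
  have h_int : Integrable (fun p : G × (Fin s → EuclideanSpace ℝ (Fin n)) =>
      gauge K ((p.1⁻¹).1 (∑ j, t j • p.2 j))) (ν.prod (volume.restrict S)) :=
    integrable_prod_of_continuous (isCompact_univ_pi fun _ => hC.2.1)
      (hcont.comp (Continuous.clm_apply (continuous_subtype_val.comp continuous_fst.inv)
        (by fun_prop)))
  obtain ⟨u, hu⟩ := exists_integral_le h_int.integral_prod_left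
  refine ⟨Unitary.linearIsometryEquiv u⁻¹, ?_⟩
  rw [setIntegral_pi_image_linearIsometryEquiv]
  have hM : 0 ≤ sphereM K := by
    rw [sphereM, average_eq]
    exact mul_nonneg (by positivity) (integral_nonneg fun ξ => gauge_nonneg _)
  calc 1 / 20000 * L * √n * sphereM K * euclNorm t
      = sphereM K * (1 / 20000 * (√n * L * euclNorm t)) := by ring
    _ ≤ sphereM K * ∫ x in S, ‖∑ j, t j • x j‖ := by
        rw [hS, volume_pi, Measure.restrict_pi_pi]
        exact mul_le_mul_of_nonneg_left (le_integral_norm_sum hC hiso t) hM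
    _ = ∫ x in S, (∫ u : G, gauge K ((u⁻¹).1 (∑ j, t j • x j)) ∂ν) := by
        rw [← integral_const_mul]
        exact integral_congr_ae (.of_forall fun x =>
          (integral_gauge_unitary_inv_apply ν hcont _).symm)
    _ = ∫ u : G, (∫ x in S, gauge K ((u⁻¹).1 (∑ j, t j • x j))) ∂ν :=
        (integral_integral_swap h_int).symm
    _ ≤ ∫ x in S, gauge K ((u⁻¹).1 (∑ j, t j • x j)) := hu
    _ = ∫ x in S, gauge K (∑ j, t j • Unitary.linearIsometryEquiv u⁻¹ (x j)) := by
        simp only [map_sum, map_smul]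
        rfl
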